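/- Let t < T be real numbers, Δ = T − t, and let {φ_j} be the shifted Legendre system on [t, T]. For j₁, j₂, j₃ ∈ ℕ define C_{j₃j₂j₁} = ∫_t^T φ_{j₃}(z) ∫_t^z φ_{j₂}(y) ∫_t^y φ_{j₁}(x) dx dy dz. Then for every j₁ ∈ ℕ, the series Σ_{j₃=0}^∞ C_{j₃j₃j₁} converges and equals (1/2)·∫_t^T (T − x) φ_{j₁}(x) dx. -/

import Mathlib

/-- The Legendre polynomial via the Rodrigues formula. -/
noncomputable def legendreP (n : ℕ) (x : ℝ) : ℝ :=
  (1 / (2 ^ n * (Nat.factorial n : ℝ))) *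
    iteratedDeriv n (fun y : ℝ => (y ^ 2 - 1) ^ n) x

/-- The shifted Legendre system on `[t, T]`. -/
noncomputable def shiftedLegendre (t T : ℝ) (j : ℕ) (x : ℝ) : ℝ :=
  Real.sqrt ((2 * (j : ℝ) + 1) / (T - t)) *
    legendreP j ((x - t - (T - t) / 2) * (2 / (T - t)))

/-- Triple Fourier–Legendre coefficient
`C_{j₃j₂j₁} = ∫_t^T φ_{j₃}(z) ∫_t^z φ_{j₂}(y) ∫_t^y φ_{j₁}(x) dx dy dz`. -/
noncomputable def tripleCoeff (t T : ℝ) (j₃ j₂ j₁ : ℕ) : ℝ :=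
  ∫ z in t..T, shiftedLegendre t T j₃ z *
    ∫ y in t..z, shiftedLegendre t T j₂ y *
      ∫ x in t..y, shiftedLegendre t T j₁ x

section

open MeasureTheory
open Polynomial hiding shiftedLegendre

/-- The Legendre polynomial of degree `n`, as an element of `ℝ[X]`. -/
noncomputable def legendrePoly (n : ℕ) : ℝ[X] :=
  C (1 / (2 ^ n * (Nat.factorial n : ℝ))) * derivative^[n] ((X ^ 2 - 1) ^ n)

theorem iteratedDeriv_eval (p : ℝ[X]) (n : ℕ) :
    iteratedDeriv n (fun x => p.eval x) = fun x => (derivative^[n] p).eval x := by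
  induction n with
  | zero => simp
  | succ n ih =>
    funext x
    rw [iteratedDeriv_succ, ih, Function.iterate_succ_apply', Polynomial.deriv]

theorem legendreP_eq_eval (n : ℕ) (x : ℝ) : legendreP n x = (legendrePoly n).eval x := by
  have h : (fun y : ℝ => (y ^ 2 - 1) ^ n) = fun y => ((X ^ 2 - 1 : ℝ[X]) ^ n).eval y := by
    funext y; simp
  rw [legendreP, h, iteratedDeriv_eval, legendrePoly, eval_mul, eval_C]

theorem natDegree_X_sq_sub_one_pow (n : ℕ) : ((X ^ 2 - 1 : ℝ[X]) ^ n).natDegree = 2 * n := by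
  have h : (X ^ 2 - 1 : ℝ[X]).natDegree = 2 := natDegree_X_pow_sub_C (r := (1 : ℝ))
  rw [natDegree_pow, h, mul_comm]

theorem coeff_X_sq_sub_one_pow (n : ℕ) : ((X ^ 2 - 1 : ℝ[X]) ^ n).coeff (2 * n) = 1 := by
  have h : (X ^ 2 - 1 : ℝ[X]).Monic := monic_X_pow_sub_C (1 : ℝ) two_ne_zero
  have := (h.pow n).coeff_natDegree
  rwa [natDegree_X_sq_sub_one_pow] at this

theorem iterate_derivative_eq_C {p : ℝ[X]} {n : ℕ} (hp : p.natDegree ≤ n) :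
    derivative^[n] p = C ((Nat.factorial n : ℝ) * p.coeff n) := by
  rw [eq_C_of_natDegree_eq_zero (p := derivative^[n] p)]
  · rw [coeff_iterate_derivative]
    simp [Nat.descFactorial_self]
  · have := natDegree_iterate_derivative p n
    omega

theorem natDegree_legendrePoly_le (n : ℕ) : (legendrePoly n).natDegree ≤ n := by
  refine (natDegree_C_mul_le _ _).trans ((natDegree_iterate_derivative _ _).trans ?_)
  rw [natDegree_X_sq_sub_one_pow]
  omega

theorem coeff_legendrePoly (n : ℕ) :
    (legendrePoly n).coeff n =
      (Nat.factorial (2 * n) : ℝ) / (2 ^ n * (Nat.factorial n : ℝ) ^ 2) := by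
  rw [legendrePoly, coeff_C_mul, coeff_iterate_derivative, ← two_mul, coeff_X_sq_sub_one_pow,
    nsmul_eq_mul, mul_one]
  have h : ((Nat.factorial n * (2 * n).descFactorial n : ℕ) : ℝ) = (Nat.factorial (2 * n) : ℕ) := by
    have := Nat.factorial_mul_descFactorial (show n ≤ 2 * n by omega)
    rw [show 2 * n - n = n by omega] at this
    rw [this]
  rw [← h]
  push_cast
  have : (Nat.factorial n : ℝ) ≠ 0 := by positivity
  field_simp

theorem degree_legendrePoly (n : ℕ) : (legendrePoly n).degree = n := by
  refine degree_eq_of_le_of_coeff_ne_zero (natDegree_le_iff_degree_le.1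
    (natDegree_legendrePoly_le n)) ?_
  rw [coeff_legendrePoly]
  positivity

theorem integral_iterate_derivative_mul (a b : ℝ) (n : ℕ) (p q : ℝ[X])
    (ha : ∀ k < n, (derivative^[k] p).eval a = 0) (hb : ∀ k < n, (derivative^[k] p).eval b = 0) :
    ∫ x in a..b, (derivative^[n] p).eval x * q.eval x =
      (-1) ^ n * ∫ x in a..b, p.eval x * (derivative^[n] q).eval x := by
  induction n generalizing q with
  | zero => simp
  | succ n ih =>
    have key := intervalIntegral.integral_mul_deriv_eq_deriv_mul (a := a) (b := b)
      (fun x _ => q.hasDerivAt x) (fun x _ => (derivative^[n] p).hasDerivAt x)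
      (q.derivative.continuous.intervalIntegrable _ _)
      ((derivative^[n] p).derivative.continuous.intervalIntegrable _ _)
    rw [ha n n.lt_succ_self, hb n n.lt_succ_self] at key
    simp only [Function.iterate_succ_apply' derivative n p, Function.iterate_succ_apply derivative n q]
    simp only [mul_comm (eval _ (derivative (derivative^[n] p)))]
    rw [key]
    simp only [mul_comm (eval _ (derivative q))]
    rw [ih _ (fun k hk => ha k (by omega)) (fun k hk => hb k (by omega))]
    ring

theorem eval_iterate_derivative_X_sq_sub_one_pow {n k : ℕ} (hk : k < n) {x : ℝ} (hx : x ^ 2 = 1) :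
    (derivative^[k] ((X ^ 2 - 1 : ℝ[X]) ^ n)).eval x = 0 := by
  obtain ⟨r, hr⟩ := pow_sub_dvd_iterate_derivative_pow (X ^ 2 - 1 : ℝ[X]) n k
  have : n - k ≠ 0 := by omega
  rw [hr]
  simp [hx, this]

theorem integral_legendrePoly_mul (n : ℕ) (q : ℝ[X]) :
    ∫ x in (-1 : ℝ)..1, (legendrePoly n).eval x * q.eval x =
      1 / (2 ^ n * (Nat.factorial n : ℝ)) *
        ∫ x in (-1 : ℝ)..1, (1 - x ^ 2) ^ n * (derivative^[n] q).eval x := by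
  have h := integral_iterate_derivative_mul (-1) 1 n ((X ^ 2 - 1) ^ n) q
    (fun k hk => eval_iterate_derivative_X_sq_sub_one_pow hk (by norm_num))
    (fun k hk => eval_iterate_derivative_X_sq_sub_one_pow hk (by norm_num))
  simp only [legendrePoly, eval_mul, eval_C, mul_assoc]
  rw [intervalIntegral.integral_const_mul, h, ← intervalIntegral.integral_const_mul]
  congr 2
  funext x
  rw [← mul_assoc, eval_pow, ← mul_pow]
  simp

theorem integral_one_sub_sq_pow (n : ℕ) :
    ∫ x in (-1 : ℝ)..1, (1 - x ^ 2) ^ n =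
      2 ^ (2 * n + 1) * (Nat.factorial n : ℝ) ^ 2 / (Nat.factorial (2 * n + 1) : ℝ) := by
  induction n with
  | zero => norm_num
  | succ n ih =>
    have key : ∫ x in (-1 : ℝ)..1,
        ((2 * (n : ℝ) + 3) * (1 - x ^ 2) ^ (n + 1) - (2 * (n : ℝ) + 2) * (1 - x ^ 2) ^ n) = 0 := by
      rw [intervalIntegral.integral_eq_sub_of_hasDerivAt
        (f := fun x : ℝ => x * (1 - x ^ 2) ^ (n + 1))]
      · simp
      · intro x _
        have := (hasDerivAt_id x).mul ((((hasDerivAt_id x).pow 2).const_sub 1).pow (n + 1))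
        convert! this using 1
        simp
        ring
      · exact Continuous.intervalIntegrable (by fun_prop) _ _
    rw [intervalIntegral.integral_sub (Continuous.intervalIntegrable (by fun_prop) _ _)
      (Continuous.intervalIntegrable (by fun_prop) _ _), intervalIntegral.integral_const_mul,
      intervalIntegral.integral_const_mul, ih] at key
    have h3 : (2 * (n : ℝ) + 3) ≠ 0 := by positivity
    have hf : ((Nat.factorial (2 * n + 1) : ℕ) : ℝ) ≠ 0 := by positivity
    rw [show 2 * (n + 1) + 1 = (2 * n + 1) + 1 + 1 by ring, Nat.factorial_succ (2 * n + 1 + 1),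
      Nat.factorial_succ (2 * n + 1), Nat.factorial_succ n]
    apply mul_left_cancel₀ h3
    rw [sub_eq_zero.1 key]
    push_cast
    field_simp
    ring

theorem integral_legendrePoly_mul_of_lt {m n : ℕ} (hmn : m < n) :
    ∫ x in (-1 : ℝ)..1, (legendrePoly n).eval x * (legendrePoly m).eval x = 0 := by
  rw [integral_legendrePoly_mul,
    iterate_derivative_eq_zero ((natDegree_legendrePoly_le m).trans_lt hmn)]
  simp

theorem integral_legendrePoly_mul_self (n : ℕ) :
    ∫ x in (-1 : ℝ)..1, (legendrePoly n).eval x * (legendrePoly n).eval x =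
      2 / (2 * (n : ℝ) + 1) := by
  rw [integral_legendrePoly_mul, iterate_derivative_eq_C (natDegree_legendrePoly_le n)]
  simp only [eval_C]
  rw [intervalIntegral.integral_mul_const, integral_one_sub_sq_pow, coeff_legendrePoly,
    Nat.factorial_succ]
  have h1 : (Nat.factorial n : ℝ) ≠ 0 := by positivity
  have h2 : (Nat.factorial (2 * n) : ℝ) ≠ 0 := by positivity
  push_cast
  field_simp
  ring

theorem integral_legendrePoly_mul_legendrePoly (m n : ℕ) :
    ∫ x in (-1 : ℝ)..1, (legendrePoly m).eval x * (legendrePoly n).eval x =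
      if m = n then 2 / (2 * (n : ℝ) + 1) else 0 := by
  split_ifs with h
  · rw [h, integral_legendrePoly_mul_self]
  · rcases lt_or_gt_of_ne h with h | h
    · simp only [mul_comm (eval _ (legendrePoly m))]
      exact integral_legendrePoly_mul_of_lt h
    · exact integral_legendrePoly_mul_of_lt h

/-- The shifted Legendre polynomials on `[t, T]`, as a polynomial sequence. -/
noncomputable def shiftedLegendreSeq (t T : ℝ) (h : t < T) : Polynomial.Sequence ℝ where
  elems' j := C (Real.sqrt ((2 * (j : ℝ) + 1) / (T - t))) *
    (legendrePoly j).comp (C (2 / (T - t)) * X + C (-(t + (T - t) / 2) * (2 / (T - t))))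
  degree_eq' j := by
    have h0 : 0 < T - t := sub_pos.2 h
    have h1 : Real.sqrt ((2 * (j : ℝ) + 1) / (T - t)) ≠ 0 := by positivity
    have hdeg : (C (2 / (T - t)) * X + C (-(t + (T - t) / 2) * (2 / (T - t)))).degree = 1 :=
      degree_linear (by positivity)
    rw [degree_C_mul h1, degree_comp (by rw [hdeg]; norm_num), hdeg, degree_legendrePoly]
    exact mul_one _

theorem shiftedLegendre_eq_eval {t T : ℝ} (h : t < T) (j : ℕ) (x : ℝ) :
    shiftedLegendre t T j x = (shiftedLegendreSeq t T h j).eval x := by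
  simp only [shiftedLegendre, shiftedLegendreSeq, legendreP_eq_eval, eval_mul, eval_C, eval_comp,
    eval_add, eval_X]
  congr 2
  ring

theorem continuous_shiftedLegendre {t T : ℝ} (h : t < T) (j : ℕ) :
    Continuous (shiftedLegendre t T j) := by
  rw [funext (shiftedLegendre_eq_eval h j)]
  exact Polynomial.continuous _

theorem integral_shiftedLegendre_mul {t T : ℝ} (h : t < T) (m n : ℕ) :
    ∫ x in t..T, shiftedLegendre t T m x * shiftedLegendre t T n x = if m = n then 1 else 0 := by
  have h0 : 0 < T - t := sub_pos.2 h
  have hc : 2 / (T - t) ≠ 0 := by positivity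
  have h1 : ∀ x, shiftedLegendre t T m x * shiftedLegendre t T n x =
      Real.sqrt ((2 * (m : ℝ) + 1) / (T - t)) * Real.sqrt ((2 * (n : ℝ) + 1) / (T - t)) *
        ((legendrePoly m).eval (2 / (T - t) * x + -(t + (T - t) / 2) * (2 / (T - t))) *
          (legendrePoly n).eval (2 / (T - t) * x + -(t + (T - t) / 2) * (2 / (T - t)))) := by
    intro x
    simp only [shiftedLegendre, legendreP_eq_eval]
    rw [show (x - t - (T - t) / 2) * (2 / (T - t)) =
      2 / (T - t) * x + -(t + (T - t) / 2) * (2 / (T - t)) by ring]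
    ring
  simp only [h1]
  rw [intervalIntegral.integral_const_mul, intervalIntegral.integral_comp_mul_add
      (fun y => (legendrePoly m).eval y * (legendrePoly n).eval y) hc,
    show 2 / (T - t) * t + -(t + (T - t) / 2) * (2 / (T - t)) = -1 by field_simp; ring,
    show 2 / (T - t) * T + -(t + (T - t) / 2) * (2 / (T - t)) = 1 by field_simp; ring,
    integral_legendrePoly_mul_legendrePoly]
  split_ifs with hmn
  · subst hmn
    rw [Real.mul_self_sqrt (by positivity), smul_eq_mul]
    field_simp
  · simp

open Set in
/-- **Parseval's identity** on an interval for an orthonormal sequence of polynomials. -/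
theorem hasSum_integral_mul_integral {t T : ℝ} (h : t ≤ T) (S : Polynomial.Sequence ℝ)
    (hS : ∀ i j, ∫ x in t..T, (S i).eval x * (S j).eval x = if i = j then 1 else 0)
    {f g : ℝ → ℝ} (hf : MemLp f 2 (volume.restrict (Icc t T)))
    (hg : MemLp g 2 (volume.restrict (Icc t T))) :
    HasSum (fun i => (∫ x in t..T, f x * (S i).eval x) * ∫ x in t..T, g x * (S i).eval x)
      (∫ x in t..T, f x * g x) := by
  let μ : Measure (Icc t T) := Measure.comap Subtype.val volume
  have hμ : MeasurePreserving (Subtype.val : Icc t T → ℝ) μ (volume.restrict (Icc t T)) :=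
    measurePreserving_subtype_coe measurableSet_Icc
  have : IsFiniteMeasure μ := ⟨by
    rw [← preimage_univ (f := Subtype.val),
      hμ.measure_preimage MeasurableSet.univ.nullMeasurableSet]
    exact measure_lt_top _ _⟩
  have h_integral : ∀ F : ℝ → ℝ, ∫ x in t..T, F x = ∫ x : Icc t T, F x ∂μ := fun F => by
    rw [intervalIntegral.integral_of_le h, ← integral_Icc_eq_integral_Ioc]
    exact (integral_subtype_comap measurableSet_Icc F).symm
  let P : ℝ[X] →ₗ[ℝ] C(Icc t T, ℝ) := (toContinuousMapOnAlgHom (Icc t T)).toLinearMap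
  let v : ℕ → Lp ℝ 2 μ := fun i => ContinuousMap.toLp 2 μ ℝ (P (S i))
  have hv : ∀ i, v i =ᵐ[μ] fun x => (S i).eval (x : ℝ) := fun i =>
    ContinuousMap.coeFn_toLp μ (P (S i))
  have hinner : ∀ {u w : Lp ℝ 2 μ} {F G : ℝ → ℝ}, u =ᵐ[μ] (fun x => F x) → w =ᵐ[μ] (fun x => G x) →
      inner ℝ u w = ∫ x in t..T, F x * G x := by
    intro u w F G hu hw
    rw [L2.inner_def, h_integral]
    refine integral_congr_ae ?_
    filter_upwards [hu, hw] with x hx hy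
    simp [hx, hy, mul_comm]
  have hortho : Orthonormal ℝ v := by
    rw [orthonormal_iff_ite]
    intro i j
    rw [hinner (F := fun x => (S i).eval x) (G := fun x => (S j).eval x) (hv i) (hv j)]
    exact hS i j
  have hspan : ⊤ ≤ (Submodule.span ℝ (range v)).topologicalClosure := by
    have hS' : Submodule.span ℝ (range S) = ⊤ := S.span fun i =>
      (leadingCoeff_ne_zero.2 (S.ne_zero i)).isUnit
    have hd := (ContinuousMap.toLp_denseRange ℝ μ ℝ (p := 2)
      (by simp)).topologicalClosure_map_submodule (s := Subalgebra.toSubmodule (polynomialFunctions (Icc t T)))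
      (congr_arg Subalgebra.toSubmodule (polynomialFunctions_closure_eq_top t T))
    rw [← hd]
    refine Submodule.topologicalClosure_mono ?_
    rintro _ ⟨_, ⟨p, -, rfl⟩, rfl⟩
    have hp : p ∈ Submodule.span ℝ (range S) := hS' ▸ Submodule.mem_top
    have := Submodule.mem_map_of_mem (f := (ContinuousMap.toLp 2 μ ℝ).toLinearMap ∘ₗ P) hp
    rw [Submodule.map_span, ← range_comp] at this
    exact this
  have hfμ : MemLp (fun x : Icc t T => f x) 2 μ := hf.comp_measurePreserving hμ
  have hgμ : MemLp (fun x : Icc t T => g x) 2 μ := hg.comp_measurePreserving hμ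
  have hsum := (HilbertBasis.mk hortho hspan).hasSum_inner_mul_inner (hfμ.toLp _) (hgμ.toLp _)
  rw [hinner hfμ.coeFn_toLp hgμ.coeFn_toLp] at hsum
  refine hsum.congr_fun fun i => ?_
  rw [HilbertBasis.coe_mk, hinner (G := fun x => (S i).eval x) hfμ.coeFn_toLp (hv i),
    real_inner_comm, hinner (G := fun x => (S i).eval x) hgμ.coeFn_toLp (hv i)]

/-- Integration by parts for the iterated integral with equal outer weights. -/
theorem integral_mul_integral_mul_integral {φ ψ : ℝ → ℝ} (hφ : Continuous φ) (hψ : Continuous ψ)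
    (t T : ℝ) :
    ∫ z in t..T, φ z * ∫ y in t..z, φ y * ∫ x in t..y, ψ x =
      (∫ x in t..T, φ x) * (∫ y in t..T, φ y * ∫ x in t..y, ψ x)
        - 1 / 2 * (∫ x in t..T, φ x) ^ 2 * (∫ x in t..T, ψ x)
        + 1 / 2 * ∫ y in t..T, (∫ x in t..y, φ x) ^ 2 * ψ y := by
  have hF : ∀ y, HasDerivAt (fun y => ∫ x in t..y, φ x) (φ y) y := fun y =>
    hφ.integral_hasStrictDerivAt t y |>.hasDerivAt
  have hG : ∀ y, HasDerivAt (fun y => ∫ x in t..y, ψ x) (ψ y) y := fun y =>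
    hψ.integral_hasStrictDerivAt t y |>.hasDerivAt
  have hFc : Continuous fun y => ∫ x in t..y, φ x :=
    continuous_iff_continuousAt.2 fun y => (hF y).continuousAt
  have hGc : Continuous fun y => ∫ x in t..y, ψ x :=
    continuous_iff_continuousAt.2 fun y => (hG y).continuousAt
  have hφG : Continuous fun y => φ y * ∫ x in t..y, ψ x := hφ.mul hGc
  have hH : ∀ y, HasDerivAt (fun z => ∫ y in t..z, φ y * ∫ x in t..y, ψ x)
      (φ y * ∫ x in t..y, ψ x) y := fun y => hφG.integral_hasStrictDerivAt t y |>.hasDerivAt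
  have h1 := intervalIntegral.integral_deriv_mul_eq_sub (fun x _ => hF x) (fun x _ => hH x)
    (hφ.intervalIntegrable t T) (hφG.intervalIntegrable t T)
  have h2 := intervalIntegral.integral_deriv_mul_eq_sub (fun x _ => (hF x).pow 2) (fun x _ => hG x)
    (Continuous.intervalIntegrable (by fun_prop) t T) (hψ.intervalIntegrable t T)
  have hHc : Continuous fun z => ∫ y in t..z, φ y * ∫ x in t..y, ψ x :=
    continuous_iff_continuousAt.2 fun y => (hH y).continuousAt
  rw [intervalIntegral.integral_add (Continuous.intervalIntegrable (by fun_prop) _ _)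
    (Continuous.intervalIntegrable (by fun_prop) _ _)] at h1 h2
  have h3 : ∫ y in t..T, (2 : ℕ) * (∫ x in t..y, φ x) ^ (2 - 1) * φ y * ∫ x in t..y, ψ x =
      2 * ∫ y in t..T, (∫ x in t..y, φ x) * (φ y * ∫ x in t..y, ψ x) := by
    rw [← intervalIntegral.integral_const_mul]
    congr 1
    funext y
    push_cast
    ring
  simp only [Pi.pow_apply] at h2
  rw [h3] at h2
  simp only [intervalIntegral.integral_same] at h1 h2
  linarith

open Set in
theorem memLp_restrict_Icc_of_continuous {f : ℝ → ℝ} (hf : Continuous f) (a b : ℝ) :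
    MemLp f 2 (volume.restrict (Icc a b)) := by
  obtain ⟨C, hC⟩ := isCompact_Icc.exists_bound_of_continuousOn (s := Icc a b) hf.continuousOn
  exact MemLp.of_bound hf.aestronglyMeasurable C
    ((ae_restrict_iff' measurableSet_Icc).2 (.of_forall hC))

open Set in
theorem integral_indicator_Iic_mul {t T y : ℝ} (hy : y ∈ Icc t T) (f : ℝ → ℝ) :
    ∫ x in t..T, (Iic y).indicator 1 x * f x = ∫ x in t..y, f x := by
  rw [intervalIntegral.integral_of_le (hy.1.trans hy.2), intervalIntegral.integral_of_le hy.1]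
  have h : (fun x => (Iic y).indicator (1 : ℝ → ℝ) x * f x) = (Iic y).indicator f := by
    funext x
    by_cases hx : x ∈ Iic y <;> simp [hx]
  rw [h, setIntegral_indicator measurableSet_Iic, Ioc_inter_Iic, min_eq_right hy.2]

open Set in
theorem hasSum_integral_shiftedLegendre_mul {t T : ℝ} (h : t < T) {f g : ℝ → ℝ}
    (hf : MemLp f 2 (volume.restrict (Icc t T))) (hg : MemLp g 2 (volume.restrict (Icc t T))) :
    HasSum (fun i => (∫ x in t..T, f x * shiftedLegendre t T i x) *
      ∫ x in t..T, g x * shiftedLegendre t T i x) (∫ x in t..T, f x * g x) := by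
  simp only [shiftedLegendre_eq_eval h]
  refine hasSum_integral_mul_integral h.le _ (fun i j => ?_) hf hg
  simpa only [shiftedLegendre_eq_eval h] using integral_shiftedLegendre_mul h i j

open Set in
theorem hasSum_sq_integral_shiftedLegendre {t T y : ℝ} (h : t < T) (hy : y ∈ Icc t T) :
    HasSum (fun i => (∫ x in t..y, shiftedLegendre t T i x) ^ 2) (y - t) := by
  have hm : MemLp ((Iic y).indicator (1 : ℝ → ℝ)) 2 (volume.restrict (Icc t T)) :=
    (memLp_const (1 : ℝ)).indicator measurableSet_Iic
  have hs := hasSum_integral_shiftedLegendre_mul h hm hm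
  simp only [integral_indicator_Iic_mul hy] at hs
  have hone : ∫ x in t..y, (Iic y).indicator (1 : ℝ → ℝ) x = y - t := by
    have := integral_indicator_Iic_mul (y := y) ⟨hy.1, le_rfl⟩ (fun _ => (1 : ℝ))
    simpa using this
  rw [hone] at hs
  simpa only [sq] using hs

open Set in
theorem hasSum_integral_sq_mul {t T : ℝ} (h : t < T) {ψ : ℝ → ℝ} (hψ : Continuous ψ) :
    HasSum (fun i => ∫ y in t..T, (∫ x in t..y, shiftedLegendre t T i x) ^ 2 * ψ y)
      (∫ y in t..T, (y - t) * ψ y) := by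
  have hFc : ∀ i, Continuous fun y => ∫ x in t..y, shiftedLegendre t T i x := fun i =>
    intervalIntegral.continuous_primitive
      (fun a b => (continuous_shiftedLegendre h i).intervalIntegrable a b) t
  have hmem : ∀ y ∈ uIoc t T, y ∈ Icc t T := fun y hy => by
    rw [uIoc_of_le h.le] at hy
    exact Ioc_subset_Icc_self hy
  have hbound : ∀ y ∈ uIoc t T, HasSum
      (fun i => (∫ x in t..y, shiftedLegendre t T i x) ^ 2 * |ψ y|) ((y - t) * |ψ y|) :=
    fun y hy => (hasSum_sq_integral_shiftedLegendre h (hmem y hy)).mul_right _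
  refine intervalIntegral.hasSum_integral_of_dominated_convergence
    (fun i y => (∫ x in t..y, shiftedLegendre t T i x) ^ 2 * |ψ y|)
    (fun i => (((hFc i).pow 2).mul hψ).aestronglyMeasurable)
    (fun i => .of_forall fun y _ => ?_) (.of_forall fun y hy => (hbound y hy).summable) ?_
    (.of_forall fun y hy => (hasSum_sq_integral_shiftedLegendre h (hmem y hy)).mul_right _)
  · rw [norm_mul, norm_pow, Real.norm_eq_abs, Real.norm_eq_abs, sq_abs]
  · refine IntervalIntegrable.congr (f := fun y => (y - t) * |ψ y|)
      (fun y hy => (hbound y hy).tsum_eq.symm) (Continuous.intervalIntegrable (by fun_prop) _ _)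

end

/-- For every `j₁`, the series `Σ_{j₃=0}^∞ C_{j₃j₃j₁}` converges to
`(1/2)·∫_t^T (T − x) φ_{j₁}(x) dx`. -/
theorem tripleCoeff_diag_sum_last (t T : ℝ) (h : t < T) (j₁ : ℕ) :
    HasSum (fun j₃ : ℕ => tripleCoeff t T j₃ j₃ j₁)
      ((1 / 2) * ∫ x in t..T, (T - x) * shiftedLegendre t T j₁ x) := by
  have hφ := continuous_shiftedLegendre h
  set ψ := shiftedLegendre t T j₁ with hψ
  have hψc : Continuous ψ := hφ j₁
  have hGd : ∀ y, HasDerivAt (fun y => ∫ x in t..y, ψ x) (ψ y) y := fun y =>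
    (hψc.integral_hasStrictDerivAt t y).hasDerivAt
  have hGc : Continuous fun y => ∫ x in t..y, ψ x :=
    continuous_iff_continuousAt.2 fun y => (hGd y).continuousAt
  have hA := hasSum_integral_shiftedLegendre_mul h
    (memLp_restrict_Icc_of_continuous (continuous_const (y := (1 : ℝ))) t T)
    (memLp_restrict_Icc_of_continuous hGc t T)
  have hB := hasSum_sq_integral_shiftedLegendre h (Set.right_mem_Icc.2 h.le)
  have hD := hasSum_integral_sq_mul h hψc
  have hparts : ∫ y in t..T, (∫ x in t..y, ψ x) = ∫ x in t..T, (T - x) * ψ x := by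
    have key := intervalIntegral.integral_mul_deriv_eq_deriv_mul
      (fun x _ => (hasDerivAt_id x).const_sub T) (fun x _ => hGd x)
      (Continuous.intervalIntegrable continuous_const t T) (hψc.intervalIntegrable t T)
    simpa using key.symm
  have hsplit : (T - t) * ∫ x in t..T, ψ x =
      (∫ x in t..T, (T - x) * ψ x) + ∫ x in t..T, (x - t) * ψ x := by
    rw [← intervalIntegral.integral_add (Continuous.intervalIntegrable (by fun_prop) _ _)
      (Continuous.intervalIntegrable (by fun_prop) _ _), ← intervalIntegral.integral_const_mul]
    congr 1
    funext x
    ring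
  simp only [one_mul] at hA
  have hsum := (hA.sub ((hB.mul_left (1 / 2)).mul_right (∫ x in t..T, ψ x))).add
    (hD.mul_left (1 / 2))
  have hval : (∫ y in t..T, (∫ x in t..y, ψ x)) - 1 / 2 * (T - t) * (∫ x in t..T, ψ x) +
      1 / 2 * ∫ y in t..T, (y - t) * ψ y = 1 / 2 * ∫ x in t..T, (T - x) * ψ x := by
    rw [hparts, mul_assoc, hsplit]
    ring
  rw [hval] at hsum
  refine hsum.congr_fun fun j => ?_
  rw [tripleCoeff, integral_mul_integral_mul_integral (hφ j) hψc]
  simp only [mul_comm]
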